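/- Let M be an inverse monoid acting transitively on a set Q by injective partial functions via act : M → Q → Option Q (transitive means: for all q, q' ∈ Q there exists m ∈ M with act m q = some q'). Fix q ∈ Q and let H = Stab(q). Then: (a) for every m ∈ M with m * m⁻¹ ∈ H, act m q is defined (equals some q' for some q'); (b) for all m, n ∈ M with m * m⁻¹ ∈ H and n * n⁻¹ ∈ H, (H m)^ω = (H n)^ω if and only if act m q = act n q; (c) for every q' ∈ Q there exists m ∈ M with m * m⁻¹ ∈ H and act m q = some q'. Consequently, sending the right ω-coset (H m)^ω to the point q' with act m q = some q' is a well-defined bijection from the set of right ω-cosets of H onto Q. -/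

import Mathlib

/-- `i` is the inverse operation of an inverse monoid structure on `M`. -/
def IsInverseMonoidInv (M : Type*) [Monoid M] (i : M → M) : Prop :=
  (∀ a : M, a * i a * a = a) ∧ (∀ a : M, i a * a * i a = i a) ∧
    ∀ a b : M, a * b * a = a → b * a * b = b → b = i a

/-- The natural partial order on an inverse monoid. -/
def natLe {M : Type*} [Monoid M] (a b : M) : Prop :=
  ∃ e : M, e * e = e ∧ a = e * b

/-- `N^ω`, the set of elements lying above some element of `N`. -/
def omegaClosure {M : Type*} [Monoid M] (N : Set M) : Set M :=
  {m | ∃ n ∈ N, natLe n m}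

/-- `Y` is a right ω-coset of `H`: `Y = (H a)^ω` for some `a` with `a * a⁻¹ ∈ H`. -/
def IsRightOmegaCoset {M : Type*} [Monoid M] (i : M → M) (H Y : Set M) : Prop :=
  ∃ a : M, a * i a ∈ H ∧ Y = omegaClosure ((· * a) '' H)

/-- `act` is an action of the monoid `M` on the set `Q` by injective partial
functions. -/
def IsPartialAction {M Q : Type*} [Monoid M] (act : M → Q → Option Q) : Prop :=
  (∀ q : Q, act 1 q = some q) ∧
  (∀ (m n : M) (q : Q), act (m * n) q = (act m q).bind (act n)) ∧
  (∀ (m : M) (q₁ q₂ r : Q), act m q₁ = some r → act m q₂ = some r → q₁ = q₂)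

theorem aux_idem {M : Type*} [Monoid M] (i : M → M)
    (hi : IsInverseMonoidInv M i) (e f : M) (he : e * e = e) (hf : f * f = f) :
    (e * f) * (e * f) = e * f := by
  obtain ⟨h1, h2, h3⟩ := hi
  have a1 := h1 (e * f)
  have a2 := h2 (e * f)
  generalize hx : i (e * f) = x at a1 a2
  have k1 : x = f * x * e := by
    rw [← hx]
    symm
    apply h3 <;> rw [hx]
    · calc e * f * (f * x * e) * (e * f) = e * (f * f) * x * (e * e) * f := by
            simp only [mul_assoc]
        _ = e * f * x * (e * f) := by rw [he, hf]; simp only [mul_assoc]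
        _ = e * f := a1
    · calc f * x * e * (e * f) * (f * x * e) = f * (x * ((e * e) * (f * f)) * x) * e := by
            simp only [mul_assoc]
        _ = f * x * e := by rw [he, hf, a2]
  have k2 : x * x = x := by
    calc x * x = (f * x * e) * (f * x * e) := by rw [← k1]
      _ = f * (x * (e * f) * x) * e := by simp only [mul_assoc]
      _ = x := by rw [a2, ← k1]
  have k3 : e * f = i x := h3 _ _ a2 a1
  have k4 : x = i x := h3 _ _ (by rw [k2, k2]) (by rw [k2, k2])
  rw [k3, ← k4, k2]

theorem aux_comm {M : Type*} [Monoid M] (i : M → M)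
    (hi : IsInverseMonoidInv M i) (e f : M) (he : e * e = e) (hf : f * f = f) :
    e * f = f * e := by
  have p := aux_idem i hi e f he hf
  have r := aux_idem i hi f e hf he
  obtain ⟨h1, h2, h3⟩ := hi
  have k1 : e * f = i (e * f) := h3 _ _ (by rw [p, p]) (by rw [p, p])
  have k2 : f * e = i (e * f) := by
    apply h3
    · calc e * f * (f * e) * (e * f) = e * (f * f) * (e * e) * f := by simp only [mul_assoc]
        _ = (e * f) * (e * f) := by rw [he, hf]; simp only [mul_assoc]
        _ = e * f := p
    · calc f * e * (e * f) * (f * e) = f * (e * e) * (f * f) * e := by simp only [mul_assoc]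
        _ = (f * e) * (f * e) := by rw [he, hf]; simp only [mul_assoc]
        _ = f * e := r
  rw [k2, ← k1]

theorem aux_inv {M Q : Type*} [Monoid M] (i : M → M)
    (hi : IsInverseMonoidInv M i) (act : M → Q → Option Q)
    (hact : IsPartialAction act) (q q' : Q) (m : M) (h : act m q = some q') :
    act (i m) q' = some q := by
  obtain ⟨c1, c2, c3⟩ := hact
  have k := h
  rw [← hi.1 m, c2, c2, h, Option.bind_some, Option.bind_eq_some_iff] at k
  obtain ⟨r, hr, hr'⟩ := k
  rw [hr, c3 m r q q' hr' h]

theorem aux_coset {M Q : Type*} [Monoid M] (i : M → M)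
    (hi : IsInverseMonoidInv M i) (act : M → Q → Option Q)
    (hact : IsPartialAction act) (q q' : Q) (m : M) (h : act m q = some q') :
    omegaClosure ((· * m) '' {k : M | act k q = some q}) = {x | act x q = some q'} := by
  have hinv := aux_inv i hi act hact q q' m h
  have hc := aux_comm i hi
  obtain ⟨c1, c2, c3⟩ := hact
  obtain ⟨h1, h2, h3⟩ := hi
  ext x
  constructor
  · rintro ⟨_, ⟨k, hk, rfl⟩, e, he, hx⟩
    have hk' : act k q = some q := hk
    have a : act (e * x) q = some q' := by
      have hx' : k * m = e * x := hx
      rw [← hx', c2, hk', Option.bind_some, h]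
    rw [c2, Option.bind_eq_some_iff] at a
    obtain ⟨r, hr, hr'⟩ := a
    have b := hr
    rw [← he, c2, hr, Option.bind_some] at b
    have hqr := c3 e q r r hr b
    subst hqr
    exact hr'
  · intro hx
    have hx' : act x q = some q' := hx
    have hf : (i m * m) * (i m * m) = i m * m := by rw [← mul_assoc, h2]
    have hg : (i x * x) * (i x * x) = i x * x := by rw [← mul_assoc, h2]
    have hfg := hc _ _ hf hg
    have key : x * (i m * m) * i x * x = x * (i m * m) := by
      calc x * (i m * m) * i x * x = x * ((i m * m) * (i x * x)) := by simp only [mul_assoc]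
        _ = (x * i x * x) * (i m * m) := by rw [hfg]; simp only [mul_assoc]
        _ = x * (i m * m) := by rw [h1]
    refine ⟨x * i m * m, ⟨x * i m, ?_, rfl⟩, x * (i m * m) * i x, ?_, ?_⟩
    · change act (x * i m) q = some q
      rw [c2, hx', Option.bind_some, hinv]
    · calc x * (i m * m) * i x * (x * (i m * m) * i x)
          = (x * (i m * m) * i x * x) * (i m * m) * i x := by simp only [mul_assoc]
        _ = x * ((i m * m) * (i m * m)) * i x := by rw [key]; simp only [mul_assoc]
        _ = _ := by rw [hf]
    · rw [key, mul_assoc]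

/-- If an inverse monoid `M` acts transitively on `Q` by injective partial
functions and `H = Stab(q)`, then: (a) `act m q` is defined whenever
`m * m⁻¹ ∈ H`; (b) `(H m)^ω = (H n)^ω` iff `act m q = act n q`; (c) every point
is `act m q` for some `m` with `m * m⁻¹ ∈ H`. Consequently `(H m)^ω ↦` (the
point `q'` with `act m q = some q'`) is a well-defined bijection from the set of
right ω-cosets of `H` onto `Q`. -/
theorem coset_space_equiv_orbit {M Q : Type*} [Monoid M] (i : M → M)
    (hi : IsInverseMonoidInv M i) (act : M → Q → Option Q)
    (hact : IsPartialAction act)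
    (htrans : ∀ q q' : Q, ∃ m : M, act m q = some q') (q : Q) :
    (∀ m : M, m * i m ∈ {n : M | act n q = some q} →
      ∃ q' : Q, act m q = some q') ∧
    (∀ m n : M, m * i m ∈ {k : M | act k q = some q} →
      n * i n ∈ {k : M | act k q = some q} →
      (omegaClosure ((· * m) '' {k : M | act k q = some q}) =
          omegaClosure ((· * n) '' {k : M | act k q = some q}) ↔
        act m q = act n q)) ∧
    (∀ q' : Q, ∃ m : M, m * i m ∈ {k : M | act k q = some q} ∧
      act m q = some q') ∧
    (∃ F : Set M → Q,
      (∀ (m : M) (q' : Q), m * i m ∈ {k : M | act k q = some q} →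
        act m q = some q' →
        F (omegaClosure ((· * m) '' {k : M | act k q = some q})) = q') ∧
      (∀ Y Z : Set M, IsRightOmegaCoset i {k : M | act k q = some q} Y →
        IsRightOmegaCoset i {k : M | act k q = some q} Z → F Y = F Z → Y = Z) ∧
      (∀ q' : Q, ∃ Y : Set M,
        IsRightOmegaCoset i {k : M | act k q = some q} Y ∧ F Y = q')) := by
  have hA : ∀ m : M, act (m * i m) q = some q → ∃ q' : Q, act m q = some q' := by
    intro m hm
    rw [hact.2.1, Option.bind_eq_some_iff] at hm
    obtain ⟨r, hr, _⟩ := hm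
    exact ⟨r, hr⟩
  have hC : ∀ q' : Q, ∃ m : M, act (m * i m) q = some q ∧ act m q = some q' := by
    intro q'
    obtain ⟨m, hm⟩ := htrans q q'
    refine ⟨m, ?_, hm⟩
    rw [hact.2.1, hm, Option.bind_some, aux_inv i hi act hact q q' m hm]
  have hK := fun q' m h => aux_coset i hi act hact q q' m h
  have hinj : ∀ a b : Q, {x | act x q = some a} = {x | act x q = some b} → a = b := by
    intro a b hab
    obtain ⟨m, hm⟩ := htrans q a
    have hb : m ∈ {x | act x q = some b} := hab ▸ hm
    have hb' : act m q = some b := hb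
    exact Option.some.inj (hm.symm.trans hb')
  have hF : ∀ a : Q, Function.extend (fun a : Q => {x | act x q = some a}) id (fun _ => q)
      {x | act x q = some a} = a := fun a =>
    Function.Injective.extend_apply (f := fun a : Q => {x | act x q = some a})
      (fun a b hab => hinj a b hab) id (fun _ => q) a
  refine ⟨hA, ?_, hC, Function.extend (fun a : Q => {x | act x q = some a}) id (fun _ => q),
    ?_, ?_, ?_⟩
  · intro m n hm hn
    obtain ⟨a, ha⟩ := hA m hm
    obtain ⟨b, hb⟩ := hA n hn
    rw [hK a m ha, hK b n hb, ha, hb]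
    constructor
    · intro h
      rw [hinj a b h]
    · intro h
      rw [h]
  · intro m q' _ h
    rw [hK q' m h, hF]
  · rintro Y Z ⟨m, hm, rfl⟩ ⟨n, hn, rfl⟩ h
    obtain ⟨a, ha⟩ := hA m hm
    obtain ⟨b, hb⟩ := hA n hn
    rw [hK a m ha, hK b n hb, hF, hF] at h
    rw [hK a m ha, hK b n hb, h]
  · intro q'
    obtain ⟨m, hm, h⟩ := hC q'
    exact ⟨_, ⟨m, hm, rfl⟩, by rw [hK q' m h, hF]⟩
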